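/- Let T_{b_1},…,T_{b_K} and T_φ be positive row-stochastic matrices in ℝ^{N×N} with stationary distributions d_{b_1},…,d_{b_K} and d_φ respectively, let w_1,…,w_K ≥ 0 with Σ_{k=1}^K w_k = 1, and set d_b = Σ_{k=1}^K w_k d_{b_k}. For each k, let κ_{max,k} be the maximum, over indices i ∈ {2,…,N+1} such that deleting row i of the (N+1)×N matrix whose first row is all ones and whose remaining rows form I − T_{b_k}ᵀ yields an invertible N×N matrix, of the condition number κ of that matrix; let κ_max = max_k κ_{max,k}. If max_{k=1,…,K} ‖T_{b_k} − T_φ‖_∞ ≤ ε and ε < 1/κ_max, then ‖d_φ − d_b‖₁ ≤ Σ_{k=1}^K w_k · ε·κ_{max,k}/(1 − ε·κ_{max,k}) ≤ ε·κ_max/(1 − ε·κ_max). -/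

import Mathlib

open Matrix BigOperators

/-- The ℓ¹ norm of a vector: sum of the absolute values of its entries. -/
noncomputable def l1Norm {N : ℕ} (v : Fin N → ℝ) : ℝ := ∑ i, |v i|

/-- The operator norm induced by the ℓ¹ vector norm: maximum absolute column sum. -/
noncomputable def opNorm {N : ℕ} (M : Matrix (Fin N) (Fin N) ℝ) : ℝ :=
  ⨆ j, ∑ i, |M i j|

/-- The `‖·‖_∞` matrix norm: maximum absolute row sum. -/
noncomputable def rowNorm {N : ℕ} (M : Matrix (Fin N) (Fin N) ℝ) : ℝ :=
  ⨆ i, ∑ j, |M i j|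

/-- The condition number `κ(M) = ‖M‖₁·‖M⁻¹‖₁` with respect to the ℓ¹-induced operator norm. -/
noncomputable def condNum {N : ℕ} (M : Matrix (Fin N) (Fin N) ℝ) : ℝ :=
  opNorm M * opNorm M⁻¹

/-- The `(N+1) × N` matrix whose first row is the all-ones row vector and whose
remaining `N` rows form `I − Tᵀ`. -/
def hatMat {N : ℕ} (T : Matrix (Fin N) (Fin N) ℝ) : Matrix (Fin (N + 1)) (Fin N) ℝ :=
  Matrix.of (Fin.cons (fun _ => (1 : ℝ))
    (fun i j => ((1 : Matrix (Fin N) (Fin N) ℝ) - Tᵀ) i j))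

/-- Delete row `i` from an `(N+1) × N` matrix, yielding an `N × N` matrix. -/
def delRow {N : ℕ} (M : Matrix (Fin (N + 1)) (Fin N) ℝ) (i : Fin (N + 1)) :
    Matrix (Fin N) (Fin N) ℝ :=
  M.submatrix i.succAbove id

/-- `κ_max` for a row-stochastic matrix `T`: the maximum, over indices `i ∈ {2,…,N+1}`
(i.e. `i ≠ 0` in `Fin (N+1)`) such that deleting row `i` of `hatMat T` yields an invertible
`N×N` matrix, of the condition number of that matrix. -/
noncomputable def kappaMax {N : ℕ} (T : Matrix (Fin N) (Fin N) ℝ) : ℝ :=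
  sSup {c : ℝ | ∃ i : Fin (N + 1), i ≠ 0 ∧ IsUnit (delRow (hatMat T) i).det ∧
    c = condNum (delRow (hatMat T) i)}

theorem l1Norm_nonneg {N : ℕ} (v : Fin N → ℝ) : 0 ≤ l1Norm v :=
  Finset.sum_nonneg fun _ _ => abs_nonneg _

theorem opNorm_nonneg {N : ℕ} (M : Matrix (Fin N) (Fin N) ℝ) : 0 ≤ opNorm M :=
  Real.iSup_nonneg fun _ => Finset.sum_nonneg fun _ _ => abs_nonneg _

theorem rowNorm_nonneg {N : ℕ} (M : Matrix (Fin N) (Fin N) ℝ) : 0 ≤ rowNorm M :=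
  Real.iSup_nonneg fun _ => Finset.sum_nonneg fun _ _ => abs_nonneg _

theorem rowNorm_transpose {N : ℕ} (M : Matrix (Fin N) (Fin N) ℝ) : rowNorm Mᵀ = opNorm M := rfl

theorem col_sum_le_opNorm {N : ℕ} (M : Matrix (Fin N) (Fin N) ℝ) (j : Fin N) :
    ∑ i, |M i j| ≤ opNorm M :=
  le_ciSup (f := fun j => ∑ i, |M i j|) (Set.finite_range _).bddAbove j

theorem l1Norm_mulVec_le {N : ℕ} (M : Matrix (Fin N) (Fin N) ℝ) (v : Fin N → ℝ) :
    l1Norm (M *ᵥ v) ≤ opNorm M * l1Norm v := by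
  calc l1Norm (M *ᵥ v) ≤ ∑ i, ∑ j, |M i j| * |v j| := by
        refine Finset.sum_le_sum fun i _ => ?_
        simp only [mulVec, dotProduct, ← abs_mul]
        exact Finset.abs_sum_le_sum_abs _ _
    _ = ∑ j, (∑ i, |M i j|) * |v j| := by
        rw [Finset.sum_comm]
        simp only [Finset.sum_mul]
    _ ≤ ∑ j, opNorm M * |v j| := by
        gcongr with j
        exact col_sum_le_opNorm M j
    _ = opNorm M * l1Norm v := by rw [l1Norm, Finset.mul_sum]

theorem l1Norm_vecMul_le {N : ℕ} (v : Fin N → ℝ) (M : Matrix (Fin N) (Fin N) ℝ) :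
    l1Norm (v ᵥ* M) ≤ rowNorm M * l1Norm v := by
  simpa [← rowNorm_transpose, mulVec_transpose] using l1Norm_mulVec_le Mᵀ v

theorem l1Norm_sum_smul_le {N K : ℕ} (w : Fin K → ℝ) (hw : ∀ k, 0 ≤ w k) (v : Fin K → Fin N → ℝ) :
    l1Norm (∑ k, w k • v k) ≤ ∑ k, w k * l1Norm (v k) := by
  simp only [l1Norm, Finset.mul_sum]
  rw [Finset.sum_comm]
  refine Finset.sum_le_sum fun i _ => ?_
  rw [Finset.sum_apply]
  refine (Finset.abs_sum_le_sum_abs _ _).trans_eq (Finset.sum_congr rfl fun k _ => ?_)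
  rw [Pi.smul_apply, smul_eq_mul, abs_mul, abs_of_nonneg (hw k)]

theorem hatMat_mulVec {N : ℕ} (T : Matrix (Fin N) (Fin N) ℝ) (v : Fin N → ℝ) :
    hatMat T *ᵥ v = Fin.cons (∑ i, v i) (v - v ᵥ* T) := by
  have h : ((1 : Matrix (Fin N) (Fin N) ℝ) - Tᵀ) *ᵥ v = v - v ᵥ* T := by
    rw [sub_mulVec, one_mulVec, mulVec_transpose]
  funext i
  cases i using Fin.cases with
  | zero => simp [hatMat, mulVec, dotProduct]
  | succ i =>
    rw [Fin.cons_succ, ← h]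
    rfl

theorem delRow_mulVec {N : ℕ} (M : Matrix (Fin (N + 1)) (Fin N) ℝ) (i : Fin (N + 1))
    (v : Fin N → ℝ) : delRow M i *ᵥ v = (M *ᵥ v) ∘ i.succAbove := rfl

theorem l1Norm_comp_succAbove_le {N : ℕ} (i : Fin (N + 1)) (v : Fin (N + 1) → ℝ) :
    l1Norm (v ∘ i.succAbove) ≤ l1Norm v := by
  simp only [l1Norm, Fin.sum_univ_succAbove _ i, Function.comp_apply]
  exact le_add_of_nonneg_left (abs_nonneg _)

/-- A positive row-stochastic matrix has no nonzero invariant vector with zero total mass. -/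
theorem eq_zero_of_vecMul_eq_self {N : ℕ} {T : Matrix (Fin N) (Fin N) ℝ}
    (hpos : ∀ i j, 0 < T i j) (hrow : ∀ i, ∑ j, T i j = 1) {v : Fin N → ℝ}
    (hv : v ᵥ* T = v) (hsum : ∑ i, v i = 0) : v = 0 := by
  rcases isEmpty_or_nonempty (Fin N) with hN | hN
  · exact Subsingleton.elim _ _
  obtain ⟨p, hp⟩ := Finite.exists_min fun p : Fin N × Fin N => T p.1 p.2
  set δ := T p.1 p.2
  have hδ : 0 < δ := hpos _ _
  have hle : ∀ j, |v j| ≤ ∑ i, |v i| * (T i j - δ) := by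
    intro j
    have hj : v j = ∑ i, v i * (T i j - δ) := by
      simp only [mul_sub, Finset.sum_sub_distrib, ← Finset.sum_mul, hsum, zero_mul, sub_zero]
      exact (congrFun hv j).symm
    rw [hj]
    refine (Finset.abs_sum_le_sum_abs _ _).trans_eq (Finset.sum_congr rfl fun i _ => ?_)
    rw [abs_mul, abs_of_nonneg (sub_nonneg.2 (hp (i, j)))]
  have hcontr : l1Norm v ≤ l1Norm v * (1 - N * δ) := by
    refine (Finset.sum_le_sum fun j _ => hle j).trans_eq ?_
    rw [Finset.sum_comm, l1Norm, Finset.sum_mul]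
    refine Finset.sum_congr rfl fun i _ => ?_
    rw [← Finset.mul_sum, Finset.sum_sub_distrib, hrow]
    simp
  have hN0 : (0 : ℝ) < N := by exact_mod_cast Fin.pos_iff_nonempty.2 hN
  have hzero : l1Norm v = 0 := by
    refine le_antisymm ?_ (l1Norm_nonneg v)
    have := mul_pos hN0 hδ
    nlinarith
  funext i
  exact abs_eq_zero.1
    ((Finset.sum_eq_zero_iff_of_nonneg fun _ _ => abs_nonneg _).1 hzero i (Finset.mem_univ i))

theorem isUnit_det_delRow_hatMat {N : ℕ} {T : Matrix (Fin N) (Fin N) ℝ}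
    (hpos : ∀ i j, 0 < T i j) (hrow : ∀ i, ∑ j, T i j = 1) {i : Fin (N + 1)} (hi : i ≠ 0) :
    IsUnit (delRow (hatMat T) i).det := by
  rw [isUnit_iff_ne_zero]
  intro hdet
  obtain ⟨v, hv0, hv⟩ := exists_mulVec_eq_zero_iff.2 hdet
  refine hv0 ?_
  have hzero : ∀ r, r ≠ i → (hatMat T *ᵥ v) r = 0 := by
    intro r hr
    obtain ⟨s, rfl⟩ := Fin.exists_succAbove_eq hr
    rw [delRow_mulVec] at hv
    exact congrFun hv s
  rw [hatMat_mulVec] at hzero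
  have hsum : ∑ j, v j = 0 := by simpa using hzero 0 hi.symm
  obtain ⟨s, rfl⟩ := Fin.exists_succ_eq.2 hi
  have hne : ∀ j, j ≠ s → (v - v ᵥ* T) j = 0 := fun j hj => by
    simpa using hzero j.succ (by simpa using hj)
  have htotal : ∑ j, (v - v ᵥ* T) j = 0 := by
    simp only [Pi.sub_apply, Finset.sum_sub_distrib, vecMul, dotProduct]
    rw [Finset.sum_comm]
    simp [← Finset.mul_sum, hrow]
  have hs : (v - v ᵥ* T) s = 0 := by
    rwa [Finset.sum_eq_single s (fun j _ hj => hne j hj) (by simp)] at htotal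
  refine eq_zero_of_vecMul_eq_self hpos hrow ?_ hsum
  refine (sub_eq_zero.1 (funext fun j => ?_)).symm
  by_cases hj : j = s
  · exact hj ▸ hs
  · exact hne j hj

theorem one_le_opNorm_delRow_hatMat {N : ℕ} (hN : 0 < N) (T : Matrix (Fin N) (Fin N) ℝ)
    {i : Fin (N + 1)} (hi : i ≠ 0) : 1 ≤ opNorm (delRow (hatMat T) i) := by
  obtain ⟨r, hr⟩ := Fin.exists_succAbove_eq hi.symm
  have hrow : delRow (hatMat T) i r ⟨0, hN⟩ = 1 := by simp [delRow, hr, hatMat]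
  calc (1 : ℝ) = |delRow (hatMat T) i r ⟨0, hN⟩| := by rw [hrow, abs_one]
    _ ≤ ∑ r, |delRow (hatMat T) i r ⟨0, hN⟩| :=
        Finset.single_le_sum (f := fun r => |delRow (hatMat T) i r ⟨0, hN⟩|)
          (fun _ _ => abs_nonneg _) (Finset.mem_univ r)
    _ ≤ _ := col_sum_le_opNorm _ _

theorem condNum_le_kappaMax {N : ℕ} {T : Matrix (Fin N) (Fin N) ℝ} {i : Fin (N + 1)}
    (hi : i ≠ 0) (hdet : IsUnit (delRow (hatMat T) i).det) :
    condNum (delRow (hatMat T) i) ≤ kappaMax T := by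
  refine le_csSup (Set.Finite.bddAbove ?_) ⟨i, hi, hdet, rfl⟩
  refine (Set.finite_range fun i => condNum (delRow (hatMat T) i)).subset ?_
  rintro c ⟨i, -, -, rfl⟩
  exact ⟨i, rfl⟩

theorem kappaMax_nonneg {N : ℕ} (T : Matrix (Fin N) (Fin N) ℝ) : 0 ≤ kappaMax T := by
  refine Real.sSup_nonneg ?_
  rintro c ⟨i, -, -, rfl⟩
  exact mul_nonneg (opNorm_nonneg _) (opNorm_nonneg _)

/-- Stationary distributions of `S` and `T` differ by at most `‖T - S‖_∞ * κ_max(T)`. -/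
theorem l1Norm_stationary_sub_le {N : ℕ} {S T : Matrix (Fin N) (Fin N) ℝ}
    (hpos : ∀ i j, 0 < T i j) (hrow : ∀ i, ∑ j, T i j = 1) {d e : Fin N → ℝ}
    (hd_sum : ∑ i, d i = 1) (hd : d ᵥ* T = d)
    (he_nonneg : ∀ i, 0 ≤ e i) (he_sum : ∑ i, e i = 1) (he : e ᵥ* S = e) :
    l1Norm (e - d) ≤ rowNorm (T - S) * kappaMax T := by
  have hN : 0 < N := Nat.pos_of_ne_zero (by rintro rfl; simp at he_sum)
  obtain ⟨i, hi⟩ : ∃ i : Fin (N + 1), i ≠ 0 := ⟨Fin.last N, by simp [Fin.ext_iff, hN.ne']⟩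
  have hdet := isUnit_det_delRow_hatMat hpos hrow hi
  set A := delRow (hatMat T) i with hA
  have he_norm : l1Norm e = 1 := by
    simp only [l1Norm, abs_of_nonneg (he_nonneg _), he_sum]
  have hhat : hatMat T *ᵥ (e - d) = Fin.cons 0 (e ᵥ* (S - T)) := by
    rw [hatMat_mulVec, sub_vecMul, vecMul_sub, hd, he]
    simp [he_sum, hd_sum]
  have hAv : l1Norm (A *ᵥ (e - d)) ≤ rowNorm (T - S) := by
    calc l1Norm (A *ᵥ (e - d))
        ≤ l1Norm (hatMat T *ᵥ (e - d)) := by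
          rw [hA, delRow_mulVec]
          exact l1Norm_comp_succAbove_le i _
      _ = l1Norm (e ᵥ* (T - S)) := by
          rw [hhat, ← neg_sub T S, vecMul_neg]
          simp [l1Norm, Fin.sum_univ_succ]
      _ ≤ rowNorm (T - S) := by simpa [he_norm] using l1Norm_vecMul_le e (T - S)
  have hinv : opNorm A⁻¹ ≤ kappaMax T :=
    (le_mul_of_one_le_left (opNorm_nonneg _) (one_le_opNorm_delRow_hatMat hN T hi)).trans
      (condNum_le_kappaMax hi hdet)
  calc l1Norm (e - d) = l1Norm (A⁻¹ *ᵥ (A *ᵥ (e - d))) := by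
        rw [mulVec_mulVec, nonsing_inv_mul _ hdet, one_mulVec]
    _ ≤ opNorm A⁻¹ * l1Norm (A *ᵥ (e - d)) := l1Norm_mulVec_le _ _
    _ ≤ kappaMax T * rowNorm (T - S) :=
        mul_le_mul hinv hAv (l1Norm_nonneg _) (kappaMax_nonneg T)
    _ = _ := mul_comm _ _

/-- Mixture-of-policies perturbation bound: with positive row-stochastic `T_{b_k}` and `T_φ`
having stationary distributions `d_{b_k}` and `d_φ`, weights `w_k ≥ 0` summing to `1`,
`d_b = Σ_k w_k d_{b_k}`, `max_k ‖T_{b_k} − T_φ‖_∞ ≤ ε`, and `ε < 1/κ_max` where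
`κ_max = max_k κ_{max,k}`, one has
`‖d_φ − d_b‖₁ ≤ Σ_k w_k·ε·κ_{max,k}/(1 − ε·κ_{max,k}) ≤ ε·κ_max/(1 − ε·κ_max)`. -/
theorem stationary_distribution_perturbation_mixture {N K : ℕ}
    (Tb : Fin K → Matrix (Fin N) (Fin N) ℝ) (Tφ : Matrix (Fin N) (Fin N) ℝ)
    (hTb_pos : ∀ k i j, 0 < Tb k i j) (hTb_row : ∀ k i, ∑ j, Tb k i j = 1)
    (hTφ_pos : ∀ i j, 0 < Tφ i j) (hTφ_row : ∀ i, ∑ j, Tφ i j = 1)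
    (db : Fin K → Fin N → ℝ) (dφ : Fin N → ℝ)
    (hdb_nonneg : ∀ k i, 0 ≤ db k i) (hdb_sum : ∀ k, ∑ i, db k i = 1)
    (hdb_stat : ∀ k, Matrix.vecMul (db k) (Tb k) = db k)
    (hdφ_nonneg : ∀ i, 0 ≤ dφ i) (hdφ_sum : ∑ i, dφ i = 1)
    (hdφ_stat : Matrix.vecMul dφ Tφ = dφ)
    (w : Fin K → ℝ) (hw_nonneg : ∀ k, 0 ≤ w k) (hw_sum : ∑ k, w k = 1)
    (dbMix : Fin N → ℝ) (hdbMix : dbMix = ∑ k, w k • db k)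
    (ε : ℝ) (hε : ∀ k, rowNorm (Tb k - Tφ) ≤ ε)
    (hεκ : ε < 1 / (⨆ k, kappaMax (Tb k))) :
    l1Norm (dφ - dbMix) ≤ ∑ k, w k * (ε * kappaMax (Tb k) / (1 - ε * kappaMax (Tb k)))
    ∧ (∑ k, w k * (ε * kappaMax (Tb k) / (1 - ε * kappaMax (Tb k))))
        ≤ ε * (⨆ k, kappaMax (Tb k)) / (1 - ε * (⨆ k, kappaMax (Tb k))) := by
  have hK : Nonempty (Fin K) := by
    by_contra h
    rw [not_nonempty_iff] at h
    simp at hw_sum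
  have hε0 : 0 ≤ ε := (rowNorm_nonneg _).trans (hε hK.some)
  set κ := ⨆ k, kappaMax (Tb k)
  have hκ : ∀ k, kappaMax (Tb k) ≤ κ := le_ciSup (Set.finite_range _).bddAbove
  have hκ0 : 0 < κ := one_div_pos.1 (hε0.trans_lt hεκ)
  have hden : 0 < 1 - ε * κ := sub_pos.2 ((lt_div_iff₀ hκ0).1 hεκ)
  have hmul : ∀ k, ε * kappaMax (Tb k) ≤ ε * κ := fun k => mul_le_mul_of_nonneg_left (hκ k) hε0
  have hmul0 : ∀ k, 0 ≤ ε * kappaMax (Tb k) := fun k => mul_nonneg hε0 (kappaMax_nonneg _)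
  constructor
  · have hmix : dφ - dbMix = ∑ k, w k • (dφ - db k) := by
      simp only [smul_sub, Finset.sum_sub_distrib, ← Finset.sum_smul, hw_sum, one_smul, hdbMix]
    rw [hmix]
    refine (l1Norm_sum_smul_le w hw_nonneg _).trans (Finset.sum_le_sum fun k _ => ?_)
    refine mul_le_mul_of_nonneg_left ?_ (hw_nonneg k)
    calc l1Norm (dφ - db k) ≤ rowNorm (Tb k - Tφ) * kappaMax (Tb k) :=
          l1Norm_stationary_sub_le (hTb_pos k) (hTb_row k) (hdb_sum k) (hdb_stat k)
            hdφ_nonneg hdφ_sum hdφ_stat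
      _ ≤ ε * kappaMax (Tb k) := mul_le_mul_of_nonneg_right (hε k) (kappaMax_nonneg _)
      _ ≤ _ := le_div_self (hmul0 k) (by linarith [hmul k]) (by linarith [hmul0 k])
  · calc _ ≤ ∑ k, w k * (ε * κ / (1 - ε * κ)) := by
          refine Finset.sum_le_sum fun k _ => mul_le_mul_of_nonneg_left ?_ (hw_nonneg k)
          exact div_le_div₀ ((hmul0 k).trans (hmul k)) (hmul k) hden (by linarith [hmul k])
      _ = _ := by rw [← Finset.sum_mul, hw_sum, one_mul]
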